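/- Let Ω ⊆ ℂⁿ be a pseudoconvex domain (nonempty, open, connected, admitting a smooth plurisubharmonic exhaustion function). Then there exist a smooth function r : Ω → ℝ and a strictly increasing sequence of real numbers (c_j)_{j≥1} tending to +∞ such that: r is a strictly plurisubharmonic exhaustion function of Ω (Hr(z; ξ) > 0 for all z ∈ Ω and all ξ ≠ 0, and every sublevel set {r < c} has compact closure contained in Ω); Dr_z ≠ 0 whenever r(z) = c_j; and the open sets Ω_j := {z ∈ Ω : r(z) < c_j} satisfy (i) Ω_j ⊆ Ω_{j+1} and the closure of Ω_j is a compact subset of Ω, (ii) ⋃_{j≥1} Ω_j = Ω, and (iii) each Ω_j has only finitely many connected components, the closures of distinct components are disjoint, and each component is a bounded connected open set with smooth boundary defined by the smooth strictly plurisubharmonic function r − c_j (in particular it is Levi pseudoconvex). -/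

import Mathlib

open MeasureTheory Complex Metric Set

noncomputable section

/-- The Wirtinger derivative `∂φ/∂z̄_j` of `φ : ℂⁿ → ℂ`:
`(1/2)(Dφ_z(e_j) + i·Dφ_z(i·e_j))`. -/
def dbarCoord (n : ℕ) (φ : (Fin n → ℂ) → ℂ) (j : Fin n) (z : Fin n → ℂ) : ℂ :=
  (1 / 2) * (fderiv ℝ φ z (Pi.single j 1) + Complex.I * fderiv ℝ φ z (Pi.single j Complex.I))

/-- A test function on `Ω`: smooth with compact support contained in `Ω`. -/
def IsTest (n : ℕ) (Ω : Set (Fin n → ℂ)) (φ : (Fin n → ℂ) → ℂ) : Prop :=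
  ContDiff ℝ (⊤ : ℕ∞) φ ∧ HasCompactSupport φ ∧ tsupport φ ⊆ Ω

/-- `∂̄u = α` distributionally on `Ω`. -/
def DbarEq (n : ℕ) (Ω : Set (Fin n → ℂ)) (u : (Fin n → ℂ) → ℂ)
    (α : Fin n → (Fin n → ℂ) → ℂ) : Prop :=
  ∀ j : Fin n, ∀ φ : (Fin n → ℂ) → ℂ, IsTest n Ω φ →
    ∫ z in Ω, α j z * φ z = - ∫ z in Ω, u z * dbarCoord n φ j z

/-- `α` is `∂̄`-closed on `Ω`. -/
def DbarClosed (n : ℕ) (Ω : Set (Fin n → ℂ)) (α : Fin n → (Fin n → ℂ) → ℂ) : Prop :=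
  ∀ j k : Fin n, ∀ φ : (Fin n → ℂ) → ℂ, IsTest n Ω φ →
    ∫ z in Ω, α j z * dbarCoord n φ k z = ∫ z in Ω, α k z * dbarCoord n φ j z

/-- The complex Hessian `Hf(z;ξ) = (1/4)(D²f_z(ξ,ξ) + D²f_z(iξ,iξ))`. -/
def hessC (n : ℕ) (f : (Fin n → ℂ) → ℝ) (z ξ : Fin n → ℂ) : ℝ :=
  (1 / 4) * (iteratedFDeriv ℝ 2 f z ![ξ, ξ]
    + iteratedFDeriv ℝ 2 f z ![Complex.I • ξ, Complex.I • ξ])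

/-- The pairing `⟨∂f(z), ξ⟩ = (1/2)(Df_z(ξ) − i·Df_z(iξ))`. -/
def delPair (n : ℕ) (f : (Fin n → ℂ) → ℝ) (z ξ : Fin n → ℂ) : ℂ :=
  (1 / 2) * ((fderiv ℝ f z ξ : ℂ) - Complex.I * (fderiv ℝ f z (Complex.I • ξ) : ℂ))

/-- Squared Euclidean norm of `ξ ∈ ℂⁿ`. -/
def enormSq (n : ℕ) (ξ : Fin n → ℂ) : ℝ := ∑ j, Complex.normSq (ξ j)

/-- The twisted curvature expression
`Θ_{λ,τ}(z;ξ) = τ(z)·Hλ(z;ξ) − Hτ(z;ξ) − τ(z)⁻¹·|⟨∂τ(z),ξ⟩|²`. -/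
def Theta (n : ℕ) (lam tau : (Fin n → ℂ) → ℝ) (z ξ : Fin n → ℂ) : ℝ :=
  tau z * hessC n lam z ξ - hessC n tau z ξ - (tau z)⁻¹ * Complex.normSq (delPair n tau z ξ)

/-- `Φ` is an exhaustion function of `Ω`: every sublevel set has compact closure inside `Ω`. -/
def ExhaustsOn (n : ℕ) (Ω : Set (Fin n → ℂ)) (Φ : (Fin n → ℂ) → ℝ) : Prop :=
  ∀ c : ℝ, IsCompact (closure {z ∈ Ω | Φ z < c}) ∧ closure {z ∈ Ω | Φ z < c} ⊆ Ω

/-- `Ω` is pseudoconvex: it admits a smooth plurisubharmonic exhaustion function. -/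
def Pseudoconvex (n : ℕ) (Ω : Set (Fin n → ℂ)) : Prop :=
  ∃ Φ : (Fin n → ℂ) → ℝ, ContDiffOn ℝ (⊤ : ℕ∞) Φ Ω ∧ (∀ z ∈ Ω, ∀ ξ, 0 ≤ hessC n Φ z ξ) ∧
    ExhaustsOn n Ω Φ

/-- `r` is a smooth defining function for `Ω` which is Levi pseudoconvex. -/
def IsLeviDefiningFn (n : ℕ) (Ω : Set (Fin n → ℂ)) (r : (Fin n → ℂ) → ℝ) : Prop :=
  ContDiff ℝ (⊤ : ℕ∞) r ∧ Ω = {z | r z < 0} ∧ (∀ z, r z = 0 → fderiv ℝ r z ≠ 0) ∧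
    (∀ p, r p = 0 → ∀ ξ, delPair n r p ξ = 0 → 0 ≤ hessC n r p ξ)

/-- The sublevel set `{z ∈ Ω : r z < c}`. -/
def sublevel {n : ℕ} (Ω : Set (Fin n → ℂ)) (r : (Fin n → ℂ) → ℝ) (c : ℝ) :
    Set (Fin n → ℂ) := {z ∈ Ω | r z < c}

section Topology

variable {X : Type*} [TopologicalSpace X] {U V : Set X}

/-- If the trace of `V` on `U` is preconnected, any two components of `U` meeting `V` agree. -/
lemma connectedComponentIn_eq_of_isPreconnected_inter (hV : IsPreconnected (V ∩ U)) {z w a b : X}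
    (ha : a ∈ V) (haz : a ∈ connectedComponentIn U z)
    (hb : b ∈ V) (hbw : b ∈ connectedComponentIn U w) :
    connectedComponentIn U z = connectedComponentIn U w := by
  have haU := connectedComponentIn_subset U z haz
  have hbU := connectedComponentIn_subset U w hbw
  have hba : b ∈ connectedComponentIn U a :=
    hV.subset_connectedComponentIn ⟨ha, haU⟩ inter_subset_right ⟨hb, hbU⟩
  rw [connectedComponentIn_eq haz, connectedComponentIn_eq hba, connectedComponentIn_eq hbw]

/-- A relatively compact set which is locally connected up to its closure has finitely many
connected components. -/
lemma finite_connectedComponentIn_of_isCompact_closure (hc : IsCompact (closure U))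
    (hU : ∀ p ∈ closure U, ∃ V ∈ nhds p, IsPreconnected (V ∩ U)) :
    {K : Set X | ∃ z ∈ U, K = connectedComponentIn U z}.Finite := by
  choose! V hV hpre using hU
  obtain ⟨t, ht, hcov⟩ := hc.elim_nhds_subcover V hV
  have hfin : (⋃ p ∈ t, {K : Set X | ∃ z ∈ V p ∩ U, K = connectedComponentIn U z}).Finite := by
    refine t.finite_toSet.biUnion fun p hp => Set.Subsingleton.finite ?_
    rintro _ ⟨z, hz, rfl⟩ _ ⟨w, hw, rfl⟩
    exact connectedComponentIn_eq_of_isPreconnected_inter (hpre p (ht p hp))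
      hz.1 (mem_connectedComponentIn hz.2) hw.1 (mem_connectedComponentIn hw.2)
  refine hfin.subset ?_
  rintro _ ⟨z, hz, rfl⟩
  obtain ⟨p, hp, hzp⟩ := mem_iUnion₂.1 (hcov (subset_closure hz))
  exact mem_iUnion₂.2 ⟨p, hp, z, ⟨hzp, hz⟩, rfl⟩

/-- Distinct components of a set which is locally connected up to its closure have disjoint
closures. -/
lemma disjoint_closure_connectedComponentIn
    (hU : ∀ p ∈ closure U, ∃ V ∈ nhds p, IsPreconnected (V ∩ U)) {z w : X}
    (hzw : connectedComponentIn U z ≠ connectedComponentIn U w) :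
    Disjoint (closure (connectedComponentIn U z)) (closure (connectedComponentIn U w)) := by
  rw [Set.disjoint_left]
  intro p hpz hpw
  obtain ⟨V, hV, hpre⟩ := hU p (closure_mono (connectedComponentIn_subset U z) hpz)
  obtain ⟨a, haV, ha⟩ := mem_closure_iff_nhds.1 hpz V hV
  obtain ⟨b, hbV, hb⟩ := mem_closure_iff_nhds.1 hpw V hV
  exact hzw (connectedComponentIn_eq_of_isPreconnected_inter hpre haV ha hbV hb)

/-- The frontier of a component of an open set avoids that set. -/
lemma notMem_of_mem_frontier_connectedComponentIn [LocallyConnectedSpace X] (hU : IsOpen U)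
    {z p : X} (hp : p ∈ frontier (connectedComponentIn U z)) : p ∉ U := by
  intro hpU
  have hopen : IsOpen (connectedComponentIn U z) := hU.connectedComponentIn
  obtain ⟨q, hq, hqz⟩ := mem_closure_iff.1 hp.1 _ hU.connectedComponentIn
    (mem_connectedComponentIn hpU)
  apply hp.2
  rw [hopen.interior_eq, connectedComponentIn_eq hqz, ← connectedComponentIn_eq hq]
  exact mem_connectedComponentIn hpU

end Topology

section Calculus

variable {E : Type*} [NormedAddCommGroup E] [NormedSpace ℝ E]

/-- Near a noncritical point, a strict sublevel set has preconnected trace on a suitable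
neighbourhood. -/
lemma exists_nhds_isPreconnected_inter_sublevel [FiniteDimensional ℝ E] {Ω : Set E}
    (hΩ : IsOpen Ω) {r : E → ℝ} {p : E} (hp : p ∈ Ω) (hr : ContDiffAt ℝ 1 r p)
    (hcrit : fderiv ℝ r p ≠ 0) :
    ∃ V ∈ nhds p, IsPreconnected (V ∩ {z ∈ Ω | r z < r p}) := by
  have : CompleteSpace E := FiniteDimensional.complete ℝ E
  have hs : HasStrictFDerivAt r (fderiv ℝ r p) p := hr.hasStrictFDerivAt one_ne_zero
  have hrange : (fderiv ℝ r p).range = ⊤ := by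
    refine LinearMap.range_eq_top.2 (LinearMap.surjective fun h => hcrit ?_)
    ext v
    exact DFunLike.congr_fun h v
  set e := hs.implicitToOpenPartialHomeomorph r (fderiv ℝ r p) hrange
  have hsrc : p ∈ e.source := hs.mem_implicitToOpenPartialHomeomorph_source hrange
  have hfst : ∀ x, (e x).1 = r x := fun x => hs.implicitToOpenPartialHomeomorph_fst hrange x
  have hW : e.target ∩ e.symm ⁻¹' Ω ∈ nhds (e p) := by
    refine Filter.inter_mem (e.open_target.mem_nhds (e.map_source hsrc)) ?_
    refine (e.continuousAt_symm (e.map_source hsrc)).preimage_mem_nhds ?_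
    rw [e.left_inv hsrc]
    exact hΩ.mem_nhds hp
  obtain ⟨ε, hε, hball⟩ := Metric.mem_nhds_iff.1 hW
  refine ⟨e.source ∩ e ⁻¹' ball (e p) ε, Filter.inter_mem (e.open_source.mem_nhds hsrc)
    ((e.continuousAt hsrc).preimage_mem_nhds (ball_mem_nhds _ hε)), ?_⟩
  have himage : (e.source ∩ e ⁻¹' ball (e p) ε) ∩ {z ∈ Ω | r z < r p} =
      e.symm '' (ball (e p) ε ∩ {y | y.1 < r p}) := by
    ext z
    constructor
    · rintro ⟨⟨hz, hzb⟩, -, hzr⟩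
      exact ⟨e z, ⟨hzb, by simpa [hfst] using hzr⟩, e.left_inv hz⟩
    · rintro ⟨y, ⟨hy, hyr⟩, rfl⟩
      obtain ⟨hyt, hyΩ⟩ := hball hy
      refine ⟨⟨e.map_target hyt, ?_⟩, hyΩ, ?_⟩
      · rwa [mem_preimage, e.right_inv hyt]
      · rwa [← hfst, e.right_inv hyt]
  rw [himage]
  refine IsPreconnected.image ?_ _
    (e.continuousOn_symm.mono fun y hy => (hball hy.1).1)
  exact ((convex_ball _ _).inter
    (convex_halfSpace_lt (LinearMap.fst ℝ ℝ _).isLinear _)).isPreconnected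

/-- A `C¹` map between open subsets of a finite-dimensional space has a value with countable
fibre. -/
lemma exists_countable_fiber [FiniteDimensional ℝ E] {Ω : Set E} {G : E → E} (hΩ : IsOpen Ω)
    (hG : ContDiffOn ℝ 1 G Ω) : ∃ b, {z ∈ Ω | G z = b}.Countable := by
  borelize E
  have hd : ∀ z ∈ Ω, HasFDerivAt G (fderiv ℝ G z) z := fun z hz =>
    ((hG.contDiffAt (hΩ.mem_nhds hz)).differentiableAt one_ne_zero).hasFDerivAt
  have hnull : Measure.addHaar (G '' {z ∈ Ω | (fderiv ℝ G z).det = 0}) = 0 :=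
    addHaar_image_eq_zero_of_det_fderivWithin_eq_zero _
      (fun z hz => (hd z hz.1).hasFDerivWithinAt) fun z hz => hz.2
  obtain ⟨b, hb⟩ : ∃ b, b ∉ G '' {z ∈ Ω | (fderiv ℝ G z).det = 0} := by
    by_contra! h
    rw [eq_univ_of_forall h] at hnull
    exact (NeZero.ne (Measure.addHaar : Measure E)) (Measure.measure_univ_eq_zero.1 hnull)
  have hdisc : IsDiscrete {z ∈ Ω | G z = b} := by
    rw [isDiscrete_iff_nhdsNE]
    rintro z ⟨hz, hzb⟩
    have hdet : (fderiv ℝ G z).det ≠ 0 := fun h => hb ⟨z, ⟨hz, h⟩, hzb⟩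
    have hanti : ∃ C, AntilipschitzWith C (fderiv ℝ G z) :=
      ⟨_, ((fderiv ℝ G z).toContinuousLinearEquivOfDetNeZero hdet).antilipschitz⟩
    rw [Filter.inf_principal_eq_bot]
    filter_upwards [(hd z hz).eventually_ne hanti (c := b)] with w hw hwb using hw hwb.2
  exact ⟨b, (HereditarilyLindelofSpace.isLindelof _).countable hdisc.to_subtype⟩

/-- Some linear perturbation of a `C²` function on an open set has countably many critical
points. -/
lemma exists_countable_setOf_fderiv_eq [FiniteDimensional ℝ E] {Ω : Set E} {f : E → ℝ}
    (hΩ : IsOpen Ω) (hf : ContDiffOn ℝ 2 f Ω) :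
    ∃ ℓ : E →L[ℝ] ℝ, {z ∈ Ω | fderiv ℝ f z = ℓ}.Countable := by
  let L : (E →L[ℝ] ℝ) ≃L[ℝ] E := ContinuousLinearEquiv.ofFinrankEq <| by
    rw [← (LinearMap.toContinuousLinearMap (𝕜 := ℝ) (E := E) (F' := ℝ)).finrank_eq]
    exact Subspace.dual_finrank_eq
  have hG : ContDiffOn ℝ 1 (fun z => L (fderiv ℝ f z)) Ω :=
    L.contDiff.comp_contDiffOn (hf.fderiv_of_isOpen hΩ (by norm_num))
  obtain ⟨b, hb⟩ := exists_countable_fiber hΩ hG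
  refine ⟨L.symm b, hb.mono ?_⟩
  rintro z ⟨hz, h⟩
  exact ⟨hz, by rw [h, L.apply_symm_apply]⟩

end Calculus

/-- The complement of a countable set of reals contains a strictly increasing sequence tending
to infinity. -/
lemma exists_strictMono_tendsto_atTop_notMem {S : Set ℝ} (hS : S.Countable) :
    ∃ c : ℕ → ℝ, StrictMono c ∧ Filter.Tendsto c Filter.atTop Filter.atTop ∧ ∀ j, c j ∉ S := by
  have h : ∀ j : ℕ, ∃ x ∈ Sᶜ, (j : ℝ) < x ∧ x < j + 1 := fun j =>
    (hS.dense_compl ℝ).exists_between (lt_add_one _)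
  choose c hcS hlt hgt using h
  refine ⟨c, strictMono_nat_of_lt_succ fun j => ?_, ?_, hcS⟩
  · exact (hgt j).trans (by simpa using hlt (j + 1))
  · exact Filter.tendsto_atTop_mono (fun j => (hlt j).le) tendsto_natCast_atTop_atTop

section ComplexHessian

variable {n : ℕ} {f g : (Fin n → ℂ) → ℝ} {z : Fin n → ℂ}

lemma hessC_add (hf : ContDiffAt ℝ 2 f z) (hg : ContDiffAt ℝ 2 g z) (ξ : Fin n → ℂ) :
    hessC n (f + g) z ξ = hessC n f z ξ + hessC n g z ξ := by
  simp only [hessC, iteratedFDeriv_add_apply (i := 2) hf hg, add_apply]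
  ring

lemma hessC_continuousLinearMap (ℓ : (Fin n → ℂ) →L[ℝ] ℝ) (ξ : Fin n → ℂ) :
    hessC n ℓ z ξ = 0 := by
  have h : fderiv ℝ ℓ = fun _ => ℓ := funext fun _ => ℓ.fderiv
  simp [hessC, iteratedFDeriv_two_apply, h]

lemma enormSq_pos {ξ : Fin n → ℂ} (hξ : ξ ≠ 0) : 0 < enormSq n ξ := by
  obtain ⟨j, hj⟩ := Function.ne_iff.1 hξ
  exact Finset.sum_pos' (fun i _ => normSq_nonneg _) ⟨j, Finset.mem_univ j, normSq_pos.2 hj⟩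

lemma sq_norm_le_enormSq (z : Fin n → ℂ) : ‖z‖ ^ 2 ≤ enormSq n z := by
  have hnn : 0 ≤ enormSq n z := Finset.sum_nonneg fun i _ => normSq_nonneg _
  rw [← Real.le_sqrt (norm_nonneg z) hnn, pi_norm_le_iff_of_nonneg (Real.sqrt_nonneg _)]
  intro j
  refine Real.le_sqrt_of_sq_le ?_
  rw [← normSq_eq_norm_sq]
  exact Finset.single_le_sum (f := fun i => normSq (z i)) (fun i _ => normSq_nonneg _)
    (Finset.mem_univ j)

/-- The real derivative of `enormSq`, as a continuous linear function of the base point. -/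
def enormSqDeriv (n : ℕ) : (Fin n → ℂ) →L[ℝ] (Fin n → ℂ) →L[ℝ] ℝ :=
  ∑ j : Fin n, (2 : ℝ) •
    ((reCLM ∘L ContinuousLinearMap.proj j).smulRight (reCLM ∘L ContinuousLinearMap.proj j) +
      (imCLM ∘L ContinuousLinearMap.proj j).smulRight (imCLM ∘L ContinuousLinearMap.proj j))

lemma enormSqDeriv_apply (z ξ : Fin n → ℂ) :
    enormSqDeriv n z ξ = ∑ j, 2 * ((z j).re * (ξ j).re + (z j).im * (ξ j).im) := by
  simp [enormSqDeriv, mul_add]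

lemma hasFDerivAt_enormSq (z : Fin n → ℂ) : HasFDerivAt (enormSq n) (enormSqDeriv n z) z := by
  have h : ∀ j ∈ Finset.univ, HasFDerivAt (fun w : Fin n → ℂ => normSq (w j))
      ((2 : ℝ) • ((z j).re • (reCLM ∘L ContinuousLinearMap.proj (R := ℝ) j) +
        (z j).im • (imCLM ∘L ContinuousLinearMap.proj (R := ℝ) j))) z := by
    intro j _
    have hre := (reCLM ∘L ContinuousLinearMap.proj (R := ℝ) (φ := fun _ : Fin n => ℂ) j).hasFDerivAt
      (x := z)
    have him := (imCLM ∘L ContinuousLinearMap.proj (R := ℝ) (φ := fun _ : Fin n => ℂ) j).hasFDerivAt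
      (x := z)
    refine ((hre.mul hre).add (him.mul him)).congr_fderiv (ContinuousLinearMap.ext fun v => ?_)
    simp
    ring
  refine (HasFDerivAt.fun_sum h).congr_fderiv (ContinuousLinearMap.ext fun v => ?_)
  simp [enormSqDeriv_apply, mul_add]

lemma contDiff_enormSq : ContDiff ℝ (⊤ : ℕ∞) (enormSq n) := by
  refine ContDiff.sum fun j _ => ?_
  simp only [normSq_apply]
  have hj : ContDiff ℝ (⊤ : ℕ∞) fun w : Fin n → ℂ => w j := contDiff_apply ℝ ℂ j
  have hre := reCLM.contDiff.comp hj
  have him := imCLM.contDiff.comp hj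
  exact (hre.mul hre).add (him.mul him)

lemma hessC_enormSq (z ξ : Fin n → ℂ) : hessC n (enormSq n) z ξ = enormSq n ξ := by
  have h : fderiv ℝ (enormSq n) = enormSqDeriv n := funext fun z => (hasFDerivAt_enormSq z).fderiv
  simp only [hessC, iteratedFDeriv_two_apply, h, ContinuousLinearMap.fderiv,
    Matrix.cons_val_zero, Matrix.cons_val_one, enormSqDeriv_apply, enormSq, normSq_apply,
    ← Finset.sum_add_distrib, Finset.mul_sum]
  refine Finset.sum_congr rfl fun j _ => ?_
  simp
  ring

end ComplexHessian

/-- On a pseudoconvex open set there is a smooth strictly plurisubharmonic exhaustion function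
with countably many critical points. -/
lemma Pseudoconvex.exists_strict_exhaustion_countable_critical {n : ℕ} {Ω : Set (Fin n → ℂ)}
    (hop : IsOpen Ω) (hpsc : Pseudoconvex n Ω) :
    ∃ r : (Fin n → ℂ) → ℝ, ContDiffOn ℝ (⊤ : ℕ∞) r Ω ∧
      (∀ z ∈ Ω, ∀ ξ : Fin n → ℂ, ξ ≠ 0 → 0 < hessC n r z ξ) ∧ ExhaustsOn n Ω r ∧
      {z ∈ Ω | fderiv ℝ r z = 0}.Countable := by
  obtain ⟨Φ, hΦ, hpsh, hex⟩ := hpsc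
  have hf : ContDiffOn ℝ (⊤ : ℕ∞) (Φ + enormSq n) Ω := hΦ.add contDiff_enormSq.contDiffOn
  have htwo : (2 : WithTop ℕ∞) ≤ ((⊤ : ℕ∞) : WithTop ℕ∞) :=
    WithTop.coe_le_coe.2 le_top
  obtain ⟨ℓ, hℓ⟩ := exists_countable_setOf_fderiv_eq hop (hf.of_le htwo)
  have hat : ∀ {g : (Fin n → ℂ) → ℝ}, ContDiffOn ℝ (⊤ : ℕ∞) g Ω → ∀ z ∈ Ω, ContDiffAt ℝ 2 g z :=
    fun hg z hz => (hg.contDiffAt (hop.mem_nhds hz)).of_le htwo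
  refine ⟨Φ + enormSq n + ⇑(-ℓ), hf.add (-ℓ).contDiff.contDiffOn, fun z hz ξ hξ => ?_,
    fun c => ?_, ?_⟩
  · rw [hessC_add (hat hf z hz) (-ℓ).contDiff.contDiffAt,
      hessC_add (hat hΦ z hz) (contDiff_enormSq.of_le htwo).contDiffAt,
      hessC_continuousLinearMap, hessC_enormSq]
    linarith [hpsh z hz ξ, enormSq_pos hξ]
  · have hsub : {z ∈ Ω | (Φ + enormSq n + ⇑(-ℓ)) z < c} ⊆ {z ∈ Ω | Φ z < c + ‖ℓ‖ ^ 2 / 4} := by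
      rintro z ⟨hz, hlt⟩
      refine ⟨hz, ?_⟩
      simp only [Pi.add_apply, neg_apply] at hlt
      have hℓz := (le_abs_self _).trans (ℓ.le_opNorm z)
      nlinarith [sq_norm_le_enormSq z, sq_nonneg (‖z‖ - ‖ℓ‖ / 2)]
    obtain ⟨hc, hΩ⟩ := hex (c + ‖ℓ‖ ^ 2 / 4)
    exact ⟨hc.of_isClosed_subset isClosed_closure (closure_mono hsub),
      (closure_mono hsub).trans hΩ⟩
  · refine hℓ.mono ?_
    rintro z ⟨hz, h⟩
    refine ⟨hz, ?_⟩
    rw [fderiv_add ((hat hf z hz).differentiableAt two_ne_zero) (-ℓ).differentiableAt,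
      ContinuousLinearMap.fderiv, add_neg_eq_zero] at h
    exact h

/-- **Approximating subsets.** Every pseudoconvex domain `Ω ⊆ ℂⁿ` admits a smooth strictly
plurisubharmonic exhaustion function `r` and a strictly increasing sequence `c_j → ∞` of
regular values such that the sublevel sets `Ω_j = {r < c_j}` increase to `Ω`, have compact
closure in `Ω`, and each `Ω_j` has finitely many connected components with mutually disjoint
closures, each of which is a bounded connected open set with smooth Levi-pseudoconvex
boundary defined by `r − c_j`. -/
theorem approximating_subsets
    {n : ℕ} (Ω : Set (Fin n → ℂ)) (hne : Ω.Nonempty) (hop : IsOpen Ω)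
    (hconn : IsConnected Ω) (hpsc : Pseudoconvex n Ω) :
    ∃ (r : (Fin n → ℂ) → ℝ) (c : ℕ → ℝ),
      ContDiffOn ℝ (⊤ : ℕ∞) r Ω ∧ StrictMono c ∧
      Filter.Tendsto c Filter.atTop Filter.atTop ∧
      (∀ z ∈ Ω, ∀ ξ : Fin n → ℂ, ξ ≠ 0 → 0 < hessC n r z ξ) ∧
      ExhaustsOn n Ω r ∧
      (∀ j : ℕ, ∀ z ∈ Ω, r z = c j → fderiv ℝ r z ≠ 0) ∧
      (∀ j : ℕ, sublevel Ω r (c j) ⊆ sublevel Ω r (c (j + 1)) ∧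
        IsCompact (closure (sublevel Ω r (c j))) ∧ closure (sublevel Ω r (c j)) ⊆ Ω) ∧
      (⋃ j : ℕ, sublevel Ω r (c j)) = Ω ∧
      (∀ j : ℕ,
        {K : Set (Fin n → ℂ) | ∃ z ∈ sublevel Ω r (c j),
          K = connectedComponentIn (sublevel Ω r (c j)) z}.Finite ∧
        (∀ z ∈ sublevel Ω r (c j), ∀ w ∈ sublevel Ω r (c j),
          connectedComponentIn (sublevel Ω r (c j)) z ≠
            connectedComponentIn (sublevel Ω r (c j)) w →
          Disjoint (closure (connectedComponentIn (sublevel Ω r (c j)) z))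
            (closure (connectedComponentIn (sublevel Ω r (c j)) w))) ∧
        (∀ z ∈ sublevel Ω r (c j),
          IsOpen (connectedComponentIn (sublevel Ω r (c j)) z) ∧
          IsConnected (connectedComponentIn (sublevel Ω r (c j)) z) ∧
          Bornology.IsBounded (connectedComponentIn (sublevel Ω r (c j)) z) ∧
          closure (connectedComponentIn (sublevel Ω r (c j)) z) ⊆ Ω ∧
          (∀ p ∈ frontier (connectedComponentIn (sublevel Ω r (c j)) z),
            r p = c j ∧ fderiv ℝ r p ≠ 0) ∧
          (∀ p ∈ frontier (connectedComponentIn (sublevel Ω r (c j)) z),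
            ∀ ξ : Fin n → ℂ, delPair n r p ξ = 0 → 0 ≤ hessC n r p ξ))) := by
  obtain ⟨r, hr, hstrict, hex, hcount⟩ := hpsc.exists_strict_exhaustion_countable_critical hop
  obtain ⟨c, hmono, htend, hc⟩ := exists_strictMono_tendsto_atTop_notMem (hcount.image r)
  have hreg : ∀ j : ℕ, ∀ z ∈ Ω, r z = c j → fderiv ℝ r z ≠ 0 :=
    fun j z hz hzc h0 => hc j ⟨z, ⟨hz, h0⟩, hzc⟩
  have hclosure : ∀ j, closure (sublevel Ω r (c j)) ⊆ Ω := fun j => (hex (c j)).2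
  have hle : ∀ j, ∀ p ∈ closure (sublevel Ω r (c j)), r p ≤ c j := fun j p hp =>
    le_of_tendsto_of_frequently
      (hr.continuousOn.continuousAt (hop.mem_nhds (hclosure j hp)))
      ((mem_closure_iff_frequently.1 hp).mono fun z hz => hz.2.le)
  have hopen : ∀ j, IsOpen (sublevel Ω r (c j)) := fun j =>
    hr.continuousOn.isOpen_inter_preimage hop isOpen_Iio
  have hloc : ∀ j, ∀ p ∈ closure (sublevel Ω r (c j)),
      ∃ V ∈ nhds p, IsPreconnected (V ∩ sublevel Ω r (c j)) := by
    intro j p hp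
    have hpΩ := hclosure j hp
    rcases (hle j p hp).lt_or_eq with hlt | heq
    · obtain ⟨ε, hε, hball⟩ := Metric.isOpen_iff.1 (hopen j) p ⟨hpΩ, hlt⟩
      refine ⟨ball p ε, ball_mem_nhds p hε, ?_⟩
      rw [inter_eq_left.2 hball]
      exact (convex_ball p ε).isPreconnected
    · have h := exists_nhds_isPreconnected_inter_sublevel hop hpΩ
        ((hr.contDiffAt (hop.mem_nhds hpΩ)).of_le (by exact_mod_cast le_top)) (hreg j p hpΩ heq)
      rwa [heq] at h
  have hsub : ∀ j, ∀ z, closure (connectedComponentIn (sublevel Ω r (c j)) z) ⊆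
      closure (sublevel Ω r (c j)) := fun j z => closure_mono (connectedComponentIn_subset _ _)
  have hfrontier : ∀ j, ∀ z, ∀ p ∈ frontier (connectedComponentIn (sublevel Ω r (c j)) z),
      p ∈ Ω ∧ r p = c j := by
    intro j z p hp
    have hpc := hsub j z hp.1
    refine ⟨hclosure j hpc, (hle j p hpc).antisymm (not_lt.1 fun hlt => ?_)⟩
    exact notMem_of_mem_frontier_connectedComponentIn (hopen j) hp ⟨hclosure j hpc, hlt⟩
  refine ⟨r, c, hr, hmono, htend, hstrict, hex, hreg, fun j => ⟨?_, hex (c j)⟩, ?_, fun j =>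
    ⟨finite_connectedComponentIn_of_isCompact_closure (hex (c j)).1 (hloc j),
      fun z _ w _ hzw => disjoint_closure_connectedComponentIn (hloc j) hzw,
      fun z hz => ⟨(hopen j).connectedComponentIn, isConnected_connectedComponentIn_iff.2 hz,
        (hex (c j)).1.isBounded.subset (subset_closure.trans (hsub j z)),
        (hsub j z).trans (hclosure j), fun p hp => ?_, fun p hp ξ _ => ?_⟩⟩⟩
  · exact fun z hz => ⟨hz.1, hz.2.trans (hmono j.lt_succ_self)⟩
  · refine Subset.antisymm (iUnion_subset fun j z hz => hz.1) fun z hz => ?_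
    obtain ⟨j, hj⟩ := (htend.eventually_gt_atTop (r z)).exists
    exact mem_iUnion.2 ⟨j, hz, hj⟩
  · obtain ⟨hpΩ, hpc⟩ := hfrontier j z p hp
    exact ⟨hpc, hreg j p hpΩ hpc⟩
  · rcases eq_or_ne ξ 0 with rfl | hξ
    · simp [hessC, iteratedFDeriv_two_apply]
    · exact (hstrict p (hfrontier j z p hp).1 ξ hξ).le
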